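/- The Bruhat order on W admits the following Euclidean description of lower intervals. (i) For every dominant y ∈ D and every x ∈ W: x ≤ y if and only if cen(x) ∈ Conv({w·cen(y) : w ∈ W_f}) (a hexagon). (ii) For every y = s0·z with z ∈ D and every x ∈ W: x ≤ y if and only if cen(x) ∈ Conv({cen(z), cen(s1 z), cen(s2 z), cen(s0 z), cen(s0 s1 z), cen(s0 s2 z)}). (iii) For every y = x_k with k ≥ 2 and every x ∈ W: x ≤ y if and only if cen(x) ∈ Conv({cen(x_k), cen(s1 x_k), cen(s2 s1 x_k), cen(s1 s2 s1 x_k)}). In each case the lower Bruhat interval [e,y] equals the set of elements of W whose alcove barycenter lies in the indicated bounded convex polygon. -/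

import Mathlib

noncomputable section

open scoped RealInnerProductSpace

/-- The Bruhat strict order on a Coxeter group: the transitive closure of the relation
"multiply on the left by a reflection, increasing the length". -/
def bruhatLT {B : Type*} {W : Type*} [Group W] {M : CoxeterMatrix B}
    (cs : CoxeterSystem M W) : W → W → Prop :=
  Relation.TransGen (fun a b => (∃ t, cs.IsReflection t ∧ b = t * a) ∧ cs.length a < cs.length b)

/-- The Bruhat order on a Coxeter group. -/
def bruhatLE {B : Type*} {W : Type*} [Group W] {M : CoxeterMatrix B}
    (cs : CoxeterSystem M W) (x y : W) : Prop :=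
  x = y ∨ bruhatLT cs x y

/-- The Bruhat interval `[x, y]` as a set. -/
def Iset {B : Type*} {W : Type*} [Group W] {M : CoxeterMatrix B}
    (cs : CoxeterSystem M W) (x y : W) : Set W :=
  {z | bruhatLE cs x z ∧ bruhatLE cs z y}

/-- The Bruhat covers `U(x)` of an element `x`. -/
def Uset {B : Type*} {W : Type*} [Group W] {M : CoxeterMatrix B}
    (cs : CoxeterSystem M W) (x : W) : Set W :=
  {w | bruhatLT cs x w ∧ cs.length w = cs.length x + 1}

/-- The Bruhat cocovers `L(y)` of an element `y`. -/
def Lset {B : Type*} {W : Type*} [Group W] {M : CoxeterMatrix B}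
    (cs : CoxeterSystem M W) (y : W) : Set W :=
  {w | bruhatLT cs w y ∧ cs.length y = cs.length w + 1}

/-- An interval `[x, y]` is full if it contains all Bruhat covers of `x` and all
Bruhat cocovers of `y`. -/
def FullInt {B : Type*} {W : Type*} [Group W] {M : CoxeterMatrix B}
    (cs : CoxeterSystem M W) (x y : W) : Prop :=
  Uset cs x ⊆ Iset cs x y ∧ Lset cs y ⊆ Iset cs x y

/-- Two Bruhat intervals (possibly in different Coxeter groups) are isomorphic as posets. -/
def IntervalIso {B : Type*} {W : Type*} {B' : Type*} {W' : Type*} [Group W] [Group W']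
    {M : CoxeterMatrix B} {M' : CoxeterMatrix B'}
    (cs : CoxeterSystem M W) (cs' : CoxeterSystem M' W') (x y : W) (x' y' : W') : Prop :=
  ∃ f : {z : W // bruhatLE cs x z ∧ bruhatLE cs z y} ≃
        {z : W' // bruhatLE cs' x' z ∧ bruhatLE cs' z y'},
    ∀ u v, bruhatLE cs u.1 v.1 ↔ bruhatLE cs' (f u).1 (f v).1

/-- The group `G` of generic automorphisms: the subgroup of the permutation group of `W`
generated by the Dynkin diagram automorphisms `δ`, `σ` and inversion. -/
def Gsub {W : Type*} [Group W] (dl sg : W ≃* W) : Subgroup (Equiv.Perm W) :=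
  Subgroup.closure {dl.toEquiv, sg.toEquiv, Equiv.inv W}

/-- The Euclidean plane, with coordinates taken in the basis of simple roots of `A₂`. -/
abbrev E2 : Type := ℝ × ℝ

/-- The `A₂` inner product on the plane, in which `(αᵢ, αᵢ) = 2` and `(α₁, α₂) = -1`. -/
def B2 (u v : E2) : ℝ := 2*u.1*v.1 - u.1*v.2 - u.2*v.1 + 2*u.2*v.2

/-- The simple root `α₁`. -/
def a1 : E2 := (1, 0)
/-- The simple root `α₂`. -/
def a2 : E2 := (0, 1)
/-- The fundamental weight `ϖ₁`, satisfying `(αᵢ, ϖⱼ) = δᵢⱼ`. -/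
def fw1 : E2 := (2/3, 1/3)
/-- The fundamental weight `ϖ₂`. -/
def fw2 : E2 := (1/3, 2/3)
/-- `ρ = ϖ₁ + ϖ₂ = α₁ + α₂`. -/
def rho2 : E2 := (1, 1)

/-- The affine reflection `s_{α,k}` of the plane in the line `{v | (α, v) = k}`,
for a root `α` with `(α, α) = 2`. -/
def reflE (a : E2) (k : ℝ) (v : E2) : E2 := v - (B2 a v - k) • a

/-- The barycenter of the alcove of `z`, i.e. the image under the affine action of `z` of
the barycenter `-ρ/3` of the fundamental alcove (whose vertices are `0, -ϖ₁, -ϖ₂`). -/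
def cen {W : Type*} [Group W] (act : W →* Equiv.Perm E2) (z : W) : E2 :=
  act z ((-(1/3 : ℝ)) • rho2)

/-- The weight lattice `Λ = ℤϖ₁ ⊕ ℤϖ₂`. -/
def wLat : Set E2 := {v | ∃ a b : ℤ, v = (a : ℝ) • fw1 + (b : ℝ) • fw2}

/-- The fundamental alcove `A₊`. -/
def AlcoveFund : Set E2 :=
  {v | (-1 < B2 a1 v ∧ B2 a1 v < 0) ∧ (-1 < B2 a2 v ∧ B2 a2 v < 0) ∧
    (-1 < B2 rho2 v ∧ B2 rho2 v < 0)}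

/-- The zone `F_id` of the plane. -/
def Fid : Set E2 := {v | -1 ≤ B2 a1 v ∧ -1 ≤ B2 a2 v ∧ -1 ≤ B2 rho2 v}

/-- The cone `K` of nonnegative combinations of the simple roots. -/
def coneK : Set E2 := {v | ∃ a b : ℝ, 0 ≤ a ∧ 0 ≤ b ∧ v = a • a1 + b • a2}

/-- The set `D` of dominant elements, given functions `θ, θˢ` enumerating them. -/
def Dset {W : Type*} (th ths : ℕ → ℕ → W) : Set W :=
  {w | (∃ m n, w = th m n) ∨ (∃ m n, w = ths m n)}

/-- The polygon `Pgn_{x,y} = F_id ∩ (cen x + K) ∩ (cen y - K)`. -/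
def Pgn {W : Type*} [Group W] (act : W →* Equiv.Perm E2) (x y : W) : Set E2 :=
  {v ∈ Fid | (∃ k ∈ coneK, v = cen act x + k) ∧ (∃ k ∈ coneK, v = cen act y - k)}

/-- The element `x_k`: the product of the first `k` terms of `s₁, s₂, s₀, s₁, s₂, s₀, …`. -/
def xelt {W : Type*} [Group W] {M : CoxeterMatrix (Fin 3)} (cs : CoxeterSystem M W)
    (k : ℕ) : W :=
  ((List.range k).map (fun j => cs.simple (⟨(j + 1) % 3, Nat.mod_lt _ (by norm_num)⟩ : Fin 3))).prod

/-- `zoneOf cs w v` says that `w` is one of the six elements of `W_f` and `v` lies in the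
corresponding zone `F_w` of the plane. -/
def zoneOf {W : Type*} [Group W] {M : CoxeterMatrix (Fin 3)} (cs : CoxeterSystem M W)
    (w : W) (v : E2) : Prop :=
  (w = 1 ∧ v ∈ Fid) ∨
  (w = cs.simple 1 ∧ B2 a1 v ≤ -1 ∧ -1 ≤ B2 rho2 v) ∨
  (w = cs.simple 2 ∧ B2 a2 v ≤ -1 ∧ -1 ≤ B2 rho2 v) ∨
  (w = cs.simple 1 * cs.simple 2 ∧ B2 rho2 v ≤ -1 ∧ 0 ≤ B2 a2 v) ∨
  (w = cs.simple 2 * cs.simple 1 ∧ B2 rho2 v ≤ -1 ∧ 0 ≤ B2 a1 v) ∨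
  (w = cs.simple 1 * cs.simple 2 * cs.simple 1 ∧ B2 a1 v ≤ 0 ∧ B2 a2 v ≤ 0)

/-- Thickness of the interval `[x,y]`: `x + 2αᵢ` and `y - 2αᵢ` belong to `[x,y]` and their
barycenters lie in `F_id`, for `i = 1, 2`. -/
def Thick {W : Type*} [Group W] {M : CoxeterMatrix (Fin 3)} (cs : CoxeterSystem M W)
    (act : W →* Equiv.Perm E2) (Wadd : W → E2 → W) (x y : W) : Prop :=
  Wadd x ((2 : ℝ) • a1) ∈ Iset cs x y ∧ Wadd x ((2 : ℝ) • a2) ∈ Iset cs x y ∧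
  Wadd y (-((2 : ℝ) • a1)) ∈ Iset cs x y ∧ Wadd y (-((2 : ℝ) • a2)) ∈ Iset cs x y ∧
  cen act (Wadd x ((2 : ℝ) • a1)) ∈ Fid ∧ cen act (Wadd x ((2 : ℝ) • a2)) ∈ Fid ∧
  cen act (Wadd y (-((2 : ℝ) • a1))) ∈ Fid ∧ cen act (Wadd y (-((2 : ℝ) • a2))) ∈ Fid

/-! ### Integer coordinates of alcoves

The barycenter of an alcove is `(p/3, q/3)` in the basis of simple roots, where `p`, `q` are
integers with `p + q` not divisible by `3`. -/

/-- The number of reflection lines separating the alcove with coordinates `(p, q)` from the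
fundamental one. -/
def alcLen (p q : ℤ) : ℕ :=
  ((2 * p - q) / 3 + 1).natAbs + ((2 * q - p) / 3 + 1).natAbs + ((p + q) / 3 + 1).natAbs

/-- The line `{v | 3 (α, v) = 3 k}` separates a point with `3 (α, v) = n` from the fundamental
alcove. -/
def Separates (k n : ℤ) : Prop := (0 ≤ k ∧ 3 * k < n) ∨ (k < 0 ∧ n < 3 * k)

lemma separates_of_alcLen_lt_one {p q k : ℤ} (h : (p + q) % 3 ≠ 0)
    (hl : alcLen (q - p + 3 * k) q < alcLen p q) : Separates k (2 * p - q) := by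
  have e1 : (2 * (q - p + 3 * k) - q) / 3 = 2 * k - 1 - (2 * p - q) / 3 := by omega
  have e2 : (2 * q - (q - p + 3 * k)) / 3 = (p + q) / 3 - k := by omega
  have e3 : (q - p + 3 * k + q) / 3 = (2 * q - p) / 3 + k := by omega
  rw [alcLen, alcLen, e1, e2, e3] at hl
  have f1 : 0 ≤ (p + q) / 3 - (2 * p - q) / 3 - (2 * q - p) / 3 := by omega
  have f2 : (p + q) / 3 - (2 * p - q) / 3 - (2 * q - p) / 3 ≤ 1 := by omega
  suffices (0 ≤ k ∧ k ≤ (2 * p - q) / 3) ∨ (k < 0 ∧ (2 * p - q) / 3 < k) by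
    unfold Separates
    omega
  clear e1 e2 e3 h
  generalize (p + q) / 3 = w at *
  generalize (2 * p - q) / 3 = u at *
  generalize (2 * q - p) / 3 = v at *
  omega

lemma alcLen_swap (p q : ℤ) : alcLen q p = alcLen p q := by
  rw [alcLen, alcLen, add_comm q p]
  omega

lemma separates_of_alcLen_lt_two {p q k : ℤ} (h : (p + q) % 3 ≠ 0)
    (hl : alcLen p (p - q + 3 * k) < alcLen p q) : Separates k (2 * q - p) := by
  rw [← alcLen_swap, ← alcLen_swap p q] at hl
  exact separates_of_alcLen_lt_one (by rwa [add_comm]) hl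

lemma separates_of_alcLen_lt_rho {p q k : ℤ} (h : (p + q) % 3 ≠ 0)
    (hl : alcLen (3 * k - q) (3 * k - p) < alcLen p q) : Separates k (p + q) := by
  have e1 : (2 * (3 * k - q) - (3 * k - p)) / 3 = k - 1 - (2 * q - p) / 3 := by omega
  have e2 : (2 * (3 * k - p) - (3 * k - q)) / 3 = k - 1 - (2 * p - q) / 3 := by omega
  have e3 : (3 * k - q + (3 * k - p)) / 3 = 2 * k - 1 - (p + q) / 3 := by omega
  rw [alcLen, alcLen, e1, e2, e3] at hl
  have f1 : 0 ≤ (p + q) / 3 - (2 * p - q) / 3 - (2 * q - p) / 3 := by omega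
  have f2 : (p + q) / 3 - (2 * p - q) / 3 - (2 * q - p) / 3 ≤ 1 := by omega
  suffices (0 ≤ k ∧ k ≤ (p + q) / 3) ∨ (k < 0 ∧ (p + q) / 3 < k) by
    unfold Separates
    omega
  clear e1 e2 e3 h
  generalize (p + q) / 3 = w at *
  generalize (2 * p - q) / 3 = u at *
  generalize (2 * q - p) / 3 = v at *
  omega

lemma alcLen_simple_one {p q : ℤ} (h : (p + q) % 3 ≠ 0) :
    (0 < 2 * p - q ∧ alcLen (q - p) q + 1 = alcLen p q) ∨
      (2 * p - q ≤ 0 ∧ alcLen (q - p) q = alcLen p q + 1) := by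
  have e1 : (2 * (q - p) - q) / 3 = -1 - (2 * p - q) / 3 := by omega
  have e2 : (2 * q - (q - p)) / 3 = (p + q) / 3 := by omega
  have e3 : (q - p + q) / 3 = (2 * q - p) / 3 := by omega
  rw [alcLen, alcLen, e1, e2, e3]
  omega

lemma alcLen_simple_two {p q : ℤ} (h : (p + q) % 3 ≠ 0) :
    (0 < 2 * q - p ∧ alcLen p (p - q) + 1 = alcLen p q) ∨
      (2 * q - p ≤ 0 ∧ alcLen p (p - q) = alcLen p q + 1) := by
  rw [← alcLen_swap, ← alcLen_swap p q]
  exact alcLen_simple_one (by rwa [add_comm])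

lemma alcLen_simple_zero {p q : ℤ} (h : (p + q) % 3 ≠ 0) :
    (p + q < -3 ∧ alcLen (-q - 3) (-p - 3) + 1 = alcLen p q) ∨
      (-3 ≤ p + q ∧ alcLen (-q - 3) (-p - 3) = alcLen p q + 1) := by
  have e1 : (2 * (-q - 3) - (-p - 3)) / 3 = -2 - (2 * q - p) / 3 := by omega
  have e2 : (2 * (-p - 3) - (-q - 3)) / 3 = -2 - (2 * p - q) / 3 := by omega
  have e3 : (-q - 3 + (-p - 3)) / 3 = -3 - (p + q) / 3 := by omega
  rw [alcLen, alcLen, e1, e2, e3]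
  omega

/-- The alcoves with coordinates `(p, q)` and `(p', q')` share a wall of type `i`. -/
def Nbr (i p q p' q' : ℤ) : Prop :=
  ((p + q) % 3 = 1 ∧ (p - i) % 3 = 1 ∧ p' = p + 1 ∧ q' = q) ∨
  ((p + q) % 3 = 1 ∧ (p - i) % 3 = 0 ∧ p' = p ∧ q' = q + 1) ∨
  ((p + q) % 3 = 1 ∧ (p - i) % 3 = 2 ∧ p' = p - 1 ∧ q' = q - 1) ∨
  ((p + q) % 3 = 2 ∧ (p - i) % 3 = 1 ∧ p' = p + 1 ∧ q' = q + 1) ∨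
  ((p + q) % 3 = 2 ∧ (p - i) % 3 = 0 ∧ p' = p ∧ q' = q - 1) ∨
  ((p + q) % 3 = 2 ∧ (p - i) % 3 = 2 ∧ p' = p - 1 ∧ q' = q)

lemma Nbr.unique {i p q p' q' u v : ℤ} (h : Nbr i p q p' q') (h' : Nbr i p q u v) :
    p' = u ∧ q' = v := by
  unfold Nbr at h'
  rcases h with h | h | h | h | h | h <;> omega

lemma Nbr.simple_one {i p q p' q' : ℤ} (h : Nbr i p q p' q') :
    Nbr i (q - p) q (q' - p') q' := by
  rcases h with h | h | h | h | h | h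
  · right; right; right; right; right; omega
  · right; right; right; left; omega
  · right; right; right; right; left; omega
  · right; left; omega
  · right; right; left; omega
  · left; omega

lemma Nbr.simple_two {i p q p' q' : ℤ} (h : Nbr i p q p' q') :
    Nbr i p (p - q) p' (p' - q') := by
  rcases h with h | h | h | h | h | h
  · right; right; right; left; omega
  · right; right; right; right; left; omega
  · right; right; right; right; right; omega
  · left; omega
  · right; left; omega
  · right; right; left; omega

lemma Nbr.simple_zero {i p q p' q' : ℤ} (h : Nbr i p q p' q') :
    Nbr i (-q - 3) (-p - 3) (-q' - 3) (-p' - 3) := by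
  rcases h with h | h | h | h | h | h
  · right; right; right; right; left; omega
  · right; right; right; right; right; omega
  · right; right; right; left; omega
  · right; right; left; omega
  · left; omega
  · right; left; omega

lemma Nbr.crossing_one {i p q p' q' k : ℤ} (h : Nbr i p q p' q')
    (h1 : Separates k (2 * p' - q')) (h2 : Separates k (2 * (q - p + 3 * k) - q)) :
    p' = q - p + 3 * k ∧ q' = q := by
  unfold Separates at *
  rcases h with h | h | h | h | h | h <;> omega

lemma Nbr.crossing_two {i p q p' q' k : ℤ} (h : Nbr i p q p' q')
    (h1 : Separates k (2 * q' - p')) (h2 : Separates k (2 * (p - q + 3 * k) - p)) :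
    p' = p ∧ q' = p - q + 3 * k := by
  unfold Separates at *
  rcases h with h | h | h | h | h | h <;> omega

lemma Nbr.crossing_rho {i p q p' q' k : ℤ} (h : Nbr i p q p' q')
    (h1 : Separates k (p' + q')) (h2 : Separates k (3 * k - q + (3 * k - p))) :
    p' = 3 * k - q ∧ q' = 3 * k - p := by
  unfold Separates at *
  rcases h with h | h | h | h | h | h <;> omega

/-- The hexagon with edges parallel to the roots `α₁`, `α₂`, `ρ`, possibly with degenerate edges. -/
def InHex (A B C c p q : ℤ) : Prop :=
  p ≤ A ∧ q - p ≤ A ∧ -q ≤ A + c ∧ q ≤ B ∧ p - q ≤ C ∧ -p ≤ C + c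

/-- The point with coordinates `(x/3, y/3)` in the basis of simple roots. -/
def pt (x y : ℝ) : E2 := (x / 3, y / 3)

lemma pt_mem_of_segment {s : Set E2} (hs : Convex ℝ s) {x y u v a b t : ℝ}
    (ha : pt (x + a * u) (y + a * v) ∈ s) (hb : pt (x + b * u) (y + b * v) ∈ s)
    (hat : a ≤ t) (htb : t ≤ b) : pt (x + t * u) (y + t * v) ∈ s := by
  let f : ℝ →ᵃ[ℝ] E2 := AffineMap.lineMap (pt x y) (pt (x + u) (y + v))
  have hf (r : ℝ) : f r = pt (x + r * u) (y + r * v) := by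
    ext <;> simp [f, pt, AffineMap.lineMap_apply] <;> ring
  have := (hs.affine_preimage f).ordConnected.out (x := a) (y := b)
    (by simpa [hf] using ha) (by simpa [hf] using hb) ⟨hat, htb⟩
  simpa [hf] using this

lemma pt_mem_of_horizontal {s : Set E2} (hs : Convex ℝ s) {y a b t : ℝ}
    (ha : pt a y ∈ s) (hb : pt b y ∈ s) (hat : a ≤ t) (htb : t ≤ b) : pt t y ∈ s := by
  simpa using pt_mem_of_segment hs (x := 0) (y := y) (u := 1) (v := 0)
    (by simpa using ha) (by simpa using hb) hat htb

lemma pt_mem_of_vertical {s : Set E2} (hs : Convex ℝ s) {x a b t : ℝ}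
    (ha : pt x a ∈ s) (hb : pt x b ∈ s) (hat : a ≤ t) (htb : t ≤ b) : pt x t ∈ s := by
  simpa using pt_mem_of_segment hs (x := x) (y := 0) (u := 0) (v := 1)
    (by simpa using ha) (by simpa using hb) hat htb

lemma pt_mem_of_diagonal {s : Set E2} (hs : Convex ℝ s) {d a b t : ℝ}
    (ha : pt a (d + a) ∈ s) (hb : pt b (d + b) ∈ s) (hat : a ≤ t) (htb : t ≤ b) :
    pt t (d + t) ∈ s := by
  simpa using pt_mem_of_segment hs (x := 0) (y := d) (u := 1) (v := 1)
    (by simpa using ha) (by simpa using hb) hat htb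

/-- Real points of the plane satisfying the inequalities defining `InHex`. -/
def hexRegion (A B C c : ℝ) : Set E2 :=
  {v | 3 * v.1 ≤ A ∧ 3 * (v.2 - v.1) ≤ A ∧ -(3 * v.2) ≤ A + c ∧ 3 * v.2 ≤ B ∧
    3 * (v.1 - v.2) ≤ C ∧ -(3 * v.1) ≤ C + c}

lemma convex_hexRegion (A B C c : ℝ) : Convex ℝ (hexRegion A B C c) := by
  rintro ⟨x, y⟩ ⟨h1, h2, h3, h4, h5, h6⟩ ⟨x', y'⟩ ⟨g1, g2, g3, g4, g5, g6⟩ a b ha hb hab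
  obtain rfl : b = 1 - a := by linarith
  simp only at *
  refine ⟨?_, ?_, ?_, ?_, ?_, ?_⟩ <;>
    simp only [Prod.smul_mk, Prod.mk_add_mk, smul_eq_mul] <;> nlinarith

lemma pt_mem_hexRegion_iff {A B C c p q : ℤ} :
    pt p q ∈ hexRegion A B C c ↔ InHex A B C c p q := by
  have e (r : ℝ) : 3 * (r / 3) = r := by ring
  simp only [hexRegion, InHex, pt, Set.mem_ofPred_eq, ← sub_div, e]
  norm_cast

lemma pt_mem_of_hexagon {s : Set E2} (hs : Convex ℝ s) {A B c p q : ℤ}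
    (h1 : pt A B ∈ s) (h2 : pt (B - A : ℤ) B ∈ s) (h3 : pt A (A - B : ℤ) ∈ s)
    (h4 : pt (-B - c : ℤ) (-A - c : ℤ) ∈ s) (h5 : pt (-B - c : ℤ) (A - B - c : ℤ) ∈ s)
    (h6 : pt (B - A - c : ℤ) (-A - c : ℤ) ∈ s) (h : pt p q ∈ hexRegion A B B c) : pt p q ∈ s := by
  have e (r : ℝ) : 3 * (r / 3) = r := by ring
  simp only [hexRegion, pt, Set.mem_ofPred_eq, ← sub_div, e] at h
  obtain ⟨g1, g2, g3, g4, g5, g6⟩ := h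
  push_cast at *
  rw [show (q : ℝ) = q - p + p by ring]
  rcases le_total (B - A : ℝ) (q - p) with hd | hd
  · refine pt_mem_of_diagonal hs (a := -B - c) (b := B - (q - p)) ?_ ?_ (by linarith) (by linarith)
    · exact pt_mem_of_vertical hs h4 h5 (by linarith) (by linarith)
    · rw [show (q - p + (B - (q - p)) : ℝ) = B by ring]
      exact pt_mem_of_horizontal hs h2 h1 (by linarith) (by linarith)
  · refine pt_mem_of_diagonal hs (a := -A - (q - p) - c) (b := A) ?_ ?_ (by linarith) (by linarith)
    · rw [show (q - p + (-A - (q - p) - c) : ℝ) = -A - c by ring]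
      exact pt_mem_of_horizontal hs h4 h6 (by linarith) (by linarith)
    · exact pt_mem_of_vertical hs h3 h1 (by linarith) (by linarith)

lemma pt_mem_of_trapezoid {s : Set E2} (hs : Convex ℝ s) {A B p q : ℤ}
    (h1 : pt A B ∈ s) (h2 : pt (B - A : ℤ) B ∈ s) (h3 : pt (B - A : ℤ) (-A : ℤ) ∈ s)
    (h4 : pt (-B : ℤ) (-A : ℤ) ∈ s) (h : pt p q ∈ hexRegion A B (A - B : ℤ) (0 : ℤ)) : pt p q ∈ s := by
  have e (r : ℝ) : 3 * (r / 3) = r := by ring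
  simp only [hexRegion, pt, Set.mem_ofPred_eq, ← sub_div, e] at h
  obtain ⟨g1, g2, g3, g4, g5, g6⟩ := h
  push_cast at *
  refine pt_mem_of_horizontal hs (a := B - A) (b := q + A - B)
    (pt_mem_of_vertical hs h3 h2 (by linarith) (by linarith)) ?_ (by linarith) (by linarith)
  have := pt_mem_of_diagonal hs (d := B - A) (a := -B) (b := A) (t := (q + A - B : ℝ))
    (by rwa [show (B - A + -B : ℝ) = -A by ring]) (by rwa [show (B - A + A : ℝ) = B by ring])
    (by linarith) (by linarith)
  rwa [show (B - A + (q + A - B) : ℝ) = q by ring] at this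

section Alcoves

variable {W : Type*} [Group W] {M : CoxeterMatrix (Fin 3)} {cs : CoxeterSystem M W}
  {act : W →* Equiv.Perm E2}

/-- The faithful affine action of the Weyl group of type `Ã₂` on the plane. -/
structure IsStdAction (cs : CoxeterSystem M W) (act : W →* Equiv.Perm E2) : Prop where
  zero : ∀ v, act (cs.simple 0) v = reflE rho2 (-1) v
  one : ∀ v, act (cs.simple 1) v = reflE a1 0 v
  two : ∀ v, act (cs.simple 2) v = reflE a2 0 v
  inj : Function.Injective (cen act)

/-- First integer coordinate of an alcove. -/
def cx (act : W →* Equiv.Perm E2) (x : W) : ℤ := ⌊3 * (cen act x).1⌋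

/-- Second integer coordinate of an alcove. -/
def cy (act : W →* Equiv.Perm E2) (x : W) : ℤ := ⌊3 * (cen act x).2⌋

lemma cx_of_cen {x : W} {p q : ℤ} (h : cen act x = pt p q) : cx act x = p := by
  have : 3 * (cen act x).1 = p := by rw [h, pt]; ring
  rw [cx, this, Int.floor_intCast]

lemma cy_of_cen {x : W} {p q : ℤ} (h : cen act x = pt p q) : cy act x = q := by
  have : 3 * (cen act x).2 = q := by rw [h, pt]; ring
  rw [cy, this, Int.floor_intCast]

lemma cen_mul (w x : W) : cen act (w * x) = act w (cen act x) := by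
  rw [cen, map_mul, Equiv.Perm.mul_apply, cen]

namespace IsStdAction

variable (H : IsStdAction cs act)
include H

lemma cen_zero_mul {x : W} {p q : ℝ} (h : cen act x = pt p q) :
    cen act (cs.simple 0 * x) = pt (-q - 3) (-p - 3) := by
  rw [cen_mul, h, H.zero]
  ext <;> simp [reflE, B2, rho2, pt] <;> ring

lemma cen_one_mul {x : W} {p q : ℝ} (h : cen act x = pt p q) :
    cen act (cs.simple 1 * x) = pt (q - p) q := by
  rw [cen_mul, h, H.one]
  ext <;> simp [reflE, B2, a1, pt]
  ring

lemma cen_two_mul {x : W} {p q : ℝ} (h : cen act x = pt p q) :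
    cen act (cs.simple 2 * x) = pt p (p - q) := by
  rw [cen_mul, h, H.two]
  ext <;> simp [reflE, B2, a2, pt]
  ring

omit H in
lemma cen_one : cen act 1 = pt (-1 : ℤ) (-1 : ℤ) := by
  ext <;> simp [cen, pt, rho2] <;> norm_num

lemma exists_coord (x : W) : ∃ p q : ℤ, cen act x = pt p q ∧ (p + q) % 3 ≠ 0 := by
  induction x using cs.simple_induction_left with
  | one => exact ⟨-1, -1, cen_one, by norm_num⟩
  | mul_simple_left w i ih =>
    obtain ⟨p, q, h, hpq⟩ := ih
    fin_cases i
    · exact ⟨-q - 3, -p - 3, by push_cast; exact H.cen_zero_mul h, by omega⟩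
    · exact ⟨q - p, q, by push_cast; exact H.cen_one_mul h, by omega⟩
    · exact ⟨p, p - q, by push_cast; exact H.cen_two_mul h, by omega⟩

lemma cen_eq (x : W) : cen act x = pt (cx act x) (cy act x) := by
  obtain ⟨p, q, h, -⟩ := H.exists_coord x
  rw [cx_of_cen h, cy_of_cen h, h]

lemma cen_of_coord {x : W} {p q : ℤ} (hx : cx act x = p) (hy : cy act x = q) :
    cen act x = pt p q := by
  rw [H.cen_eq, hx, hy]

lemma coord_mod (x : W) : (cx act x + cy act x) % 3 ≠ 0 := by
  obtain ⟨p, q, h, hpq⟩ := H.exists_coord x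
  rwa [cx_of_cen h, cy_of_cen h]

lemma ext {x y : W} (h1 : cx act x = cx act y) (h2 : cy act x = cy act y) : x = y :=
  H.inj (by rw [H.cen_eq x, H.cen_eq y, h1, h2])

omit H in
lemma cx_one : cx act 1 = -1 := cx_of_cen cen_one

omit H in
lemma cy_one : cy act 1 = -1 := cy_of_cen cen_one

lemma cx_zero_mul (x : W) : cx act (cs.simple 0 * x) = -cy act x - 3 :=
  cx_of_cen (q := -cx act x - 3) (by push_cast; exact H.cen_zero_mul (H.cen_eq x))

lemma cy_zero_mul (x : W) : cy act (cs.simple 0 * x) = -cx act x - 3 :=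
  cy_of_cen (p := -cy act x - 3) (by push_cast; exact H.cen_zero_mul (H.cen_eq x))

lemma cx_one_mul (x : W) : cx act (cs.simple 1 * x) = cy act x - cx act x :=
  cx_of_cen (q := cy act x) (by push_cast; exact H.cen_one_mul (H.cen_eq x))

lemma cy_one_mul (x : W) : cy act (cs.simple 1 * x) = cy act x :=
  cy_of_cen (p := cy act x - cx act x) (by push_cast; exact H.cen_one_mul (H.cen_eq x))

lemma cx_two_mul (x : W) : cx act (cs.simple 2 * x) = cx act x :=
  cx_of_cen (q := cx act x - cy act x) (by push_cast; exact H.cen_two_mul (H.cen_eq x))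

lemma cy_two_mul (x : W) : cy act (cs.simple 2 * x) = cx act x - cy act x :=
  cy_of_cen (p := cx act x) (by push_cast; exact H.cen_two_mul (H.cen_eq x))

lemma nbr (x : W) (i : Fin 3) :
    Nbr (i : ℕ) (cx act x) (cy act x) (cx act (x * cs.simple i)) (cy act (x * cs.simple i)) := by
  induction x using cs.simple_induction_left with
  | one =>
    rw [one_mul, cx_one, cy_one]
    fin_cases i
    · have h1 := H.cx_zero_mul 1
      have h2 := H.cy_zero_mul 1
      simp only [mul_one, cx_one, cy_one] at h1 h2
      simp [h1, h2, Nbr]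
    · have h1 := H.cx_one_mul 1
      have h2 := H.cy_one_mul 1
      simp only [mul_one, cx_one, cy_one] at h1 h2
      simp [h1, h2, Nbr]
    · have h1 := H.cx_two_mul 1
      have h2 := H.cy_two_mul 1
      simp only [mul_one, cx_one, cy_one] at h1 h2
      simp [h1, h2, Nbr]
  | mul_simple_left w j ih =>
    rw [mul_assoc]
    fin_cases j
    · simpa [H.cx_zero_mul, H.cy_zero_mul] using ih.simple_zero
    · simpa [H.cx_one_mul, H.cy_one_mul] using ih.simple_one
    · simpa [H.cx_two_mul, H.cy_two_mul] using ih.simple_two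

/-! ### Length and reflections -/

lemma length_eq (x : W) : cs.length x = alcLen (cx act x) (cy act x) := by
  have h0 := fun x => alcLen_simple_zero (H.coord_mod x)
  have h1 := fun x => alcLen_simple_one (H.coord_mod x)
  have h2 := fun x => alcLen_simple_two (H.coord_mod x)
  simp only [← H.cx_zero_mul, ← H.cy_zero_mul] at h0
  simp only [← H.cx_one_mul] at h1
  simp only [← H.cy_two_mul] at h2
  apply le_antisymm
  · generalize hn : alcLen (cx act x) (cy act x) = n
    induction n using Nat.strong_induction_on generalizing x with
    | _ n ih =>
      subst hn
      have hmod := H.coord_mod x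
      have descent (i : Fin 3) (hi : alcLen (cx act (cs.simple i * x)) (cy act (cs.simple i * x)) <
          alcLen (cx act x) (cy act x)) : cs.length x ≤ alcLen (cx act x) (cy act x) := by
        have h1 := ih _ hi _ rfl
        rcases cs.length_simple_mul x i with h | h <;> omega
      by_cases c1 : 0 < 2 * cx act x - cy act x
      · apply descent 1
        rw [H.cy_one_mul]
        have := h1 x
        omega
      by_cases c2 : 0 < 2 * cy act x - cx act x
      · apply descent 2
        rw [H.cx_two_mul]
        have := h2 x
        omega
      by_cases c3 : cx act x + cy act x < -3
      · apply descent 0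
        have := h0 x
        omega
      have : x = 1 := H.ext (by rw [cx_one]; omega) (by rw [cy_one]; omega)
      simp [this]
  · generalize hn : cs.length x = n
    induction n generalizing x with
    | zero =>
      rw [cs.length_eq_zero_iff] at hn
      simp [hn, cx_one, cy_one, alcLen]
    | succ n ih =>
      have hx : x ≠ 1 := by
        rintro rfl
        simp at hn
      obtain ⟨i, hi⟩ := cs.exists_leftDescent_of_ne_one hx
      rw [cs.isLeftDescent_iff] at hi
      have hle := ih (cs.simple i * x) (by omega)
      specialize h0 x
      specialize h1 x
      specialize h2 x
      fin_cases i
      · simp only [Fin.zero_eta] at hle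
        omega
      · simp only [Fin.mk_one, H.cy_one_mul] at hle
        omega
      · simp only [Fin.reduceFinMk, H.cx_two_mul] at hle
        omega

lemma reflection_cases {t : W} (ht : cs.IsReflection t) :
    (∃ k : ℤ, ∀ x, cx act (t * x) = cy act x - cx act x + 3 * k ∧ cy act (t * x) = cy act x) ∨
    (∃ k : ℤ, ∀ x, cx act (t * x) = cx act x ∧ cy act (t * x) = cx act x - cy act x + 3 * k) ∨
    (∃ k : ℤ, ∀ x, cx act (t * x) = 3 * k - cy act x ∧ cy act (t * x) = 3 * k - cx act x) := by
  obtain ⟨w, i, rfl⟩ := ht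
  induction w using cs.simple_induction_left with
  | one =>
    simp only [one_mul, inv_one, mul_one]
    fin_cases i
    · refine Or.inr (Or.inr ⟨-1, fun x => ⟨?_, ?_⟩⟩)
      · have := H.cx_zero_mul x
        simp only [Fin.zero_eta]
        omega
      · have := H.cy_zero_mul x
        simp only [Fin.zero_eta]
        omega
    · exact Or.inl ⟨0, fun x => by simp [H.cx_one_mul, H.cy_one_mul]⟩
    · exact Or.inr (Or.inl ⟨0, fun x => by simp [H.cx_two_mul, H.cy_two_mul]⟩)
  | mul_simple_left w j ih =>
    have key (x : W) : cs.simple j * w * cs.simple i * (cs.simple j * w)⁻¹ * x =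
        cs.simple j * (w * cs.simple i * w⁻¹ * (cs.simple j * x)) := by
      simp [mul_assoc]
    simp only [key]
    fin_cases j
    · simp only [Fin.zero_eta, H.cx_zero_mul, H.cy_zero_mul]
      rcases ih with ⟨k, hk⟩ | ⟨k, hk⟩ | ⟨k, hk⟩
      · refine Or.inr (Or.inl ⟨-1 - k, fun x => ?_⟩)
        rw [(hk _).1, (hk _).2, H.cx_zero_mul, H.cy_zero_mul]
        omega
      · refine Or.inl ⟨-1 - k, fun x => ?_⟩
        rw [(hk _).1, (hk _).2, H.cx_zero_mul, H.cy_zero_mul]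
        omega
      · refine Or.inr (Or.inr ⟨-2 - k, fun x => ?_⟩)
        rw [(hk _).1, (hk _).2, H.cx_zero_mul, H.cy_zero_mul]
        omega
    · simp only [Fin.mk_one, H.cx_one_mul, H.cy_one_mul]
      rcases ih with ⟨k, hk⟩ | ⟨k, hk⟩ | ⟨k, hk⟩
      · refine Or.inl ⟨-k, fun x => ?_⟩
        rw [(hk _).1, (hk _).2, H.cx_one_mul, H.cy_one_mul]
        omega
      · refine Or.inr (Or.inr ⟨k, fun x => ?_⟩)
        rw [(hk _).1, (hk _).2, H.cx_one_mul, H.cy_one_mul]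
        omega
      · refine Or.inr (Or.inl ⟨k, fun x => ?_⟩)
        rw [(hk _).1, (hk _).2, H.cx_one_mul, H.cy_one_mul]
        omega
    · simp only [Fin.reduceFinMk, H.cx_two_mul, H.cy_two_mul]
      rcases ih with ⟨k, hk⟩ | ⟨k, hk⟩ | ⟨k, hk⟩
      · refine Or.inr (Or.inr ⟨k, fun x => ?_⟩)
        rw [(hk _).1, (hk _).2, H.cx_two_mul, H.cy_two_mul]
        omega
      · refine Or.inr (Or.inl ⟨-k, fun x => ?_⟩)
        rw [(hk _).1, (hk _).2, H.cx_two_mul, H.cy_two_mul]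
        omega
      · refine Or.inl ⟨k, fun x => ?_⟩
        rw [(hk _).1, (hk _).2, H.cx_two_mul, H.cy_two_mul]
        omega

/-- A reflection which lowers an element reflects its alcove in a line separating it from the
fundamental alcove. -/
lemma reflection_separates {t : W} (ht : cs.IsReflection t) :
    (∃ k : ℤ, (∀ x, cx act (t * x) = cy act x - cx act x + 3 * k ∧ cy act (t * x) = cy act x) ∧
      ∀ x, cs.length (t * x) < cs.length x → Separates k (2 * cx act x - cy act x)) ∨
    (∃ k : ℤ, (∀ x, cx act (t * x) = cx act x ∧ cy act (t * x) = cx act x - cy act x + 3 * k) ∧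
      ∀ x, cs.length (t * x) < cs.length x → Separates k (2 * cy act x - cx act x)) ∨
    (∃ k : ℤ, (∀ x, cx act (t * x) = 3 * k - cy act x ∧ cy act (t * x) = 3 * k - cx act x) ∧
      ∀ x, cs.length (t * x) < cs.length x → Separates k (cx act x + cy act x)) := by
  simp only [H.length_eq]
  refine (H.reflection_cases ht).imp ?_ (Or.imp ?_ ?_) <;>
    refine fun ⟨k, hk⟩ => ⟨k, hk, fun x hx => ?_⟩ <;>
    rw [(hk x).1, (hk x).2] at hx
  · exact separates_of_alcLen_lt_one (H.coord_mod x) hx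
  · exact separates_of_alcLen_lt_two (H.coord_mod x) hx
  · exact separates_of_alcLen_lt_rho (H.coord_mod x) hx

lemma inHex_of_reflection {A B C c : ℤ} (hc : 0 ≤ c) (hc' : c ≤ 3) (hBC : B ≤ C)
    (hCB : C + c ≤ B + 3) {t x : W} (ht : cs.IsReflection t) (hl : cs.length (t * x) < cs.length x)
    (hx : InHex A B C c (cx act x) (cy act x)) :
    InHex A B C c (cx act (t * x)) (cy act (t * x)) := by
  rcases H.reflection_separates ht with ⟨k, hk, hs⟩ | ⟨k, hk, hs⟩ | ⟨k, hk, hs⟩ <;>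
  · have := hs x hl
    rw [(hk x).1, (hk x).2]
    unfold InHex Separates at *
    omega

lemma lt_or_eq_of_reflection {t a : W} (ht : cs.IsReflection t)
    (hl : cs.length a < cs.length (t * a)) (i : Fin 3) :
    cs.length (a * cs.simple i) < cs.length (t * (a * cs.simple i)) ∨
      a * cs.simple i = t * a := by
  by_contra! hcon
  have h1 : cs.length (t * (a * cs.simple i)) < cs.length (a * cs.simple i) :=
    lt_of_le_of_ne hcon.1 (ht.length_mul_right_ne _)
  have hta : t * (t * a) = a := by rw [← mul_assoc, ht.mul_self, one_mul]
  apply hcon.2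
  have hn := H.nbr a i
  rcases H.reflection_separates ht with ⟨k, hk, hs⟩ | ⟨k, hk, hs⟩ | ⟨k, hk, hs⟩ <;>
  · have s1 := hs _ h1
    have s2 := hs (t * a) (by rwa [hta])
    rw [(hk a).1, (hk a).2] at s2
    first
      | obtain ⟨e1, e2⟩ := hn.crossing_one s1 s2
      | obtain ⟨e1, e2⟩ := hn.crossing_two s1 s2
      | obtain ⟨e1, e2⟩ := hn.crossing_rho s1 s2
    exact H.ext (by rw [e1, (hk a).1]) (by rw [e2, (hk a).2])

/-! ### Lower intervals -/

omit H in
lemma bruhatLE_iff {x y : W} : bruhatLE cs x y ↔ Relation.ReflTransGen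
    (fun a b => (∃ t, cs.IsReflection t ∧ b = t * a) ∧ cs.length a < cs.length b) x y := by
  rw [Relation.reflTransGen_iff_eq_or_transGen, bruhatLE, bruhatLT, eq_comm]

lemma inHex_of_bruhatLE {A B C c : ℤ} (hc : 0 ≤ c) (hc' : c ≤ 3) (hBC : B ≤ C)
    (hCB : C + c ≤ B + 3) {x y : W} (h : bruhatLE cs x y)
    (hy : InHex A B C c (cx act y) (cy act y)) :
    InHex A B C c (cx act x) (cy act x) := by
  rw [bruhatLE_iff] at h
  induction h using Relation.ReflTransGen.head_induction_on with
  | refl => exact hy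
  | @head a b hab _ ih =>
    obtain ⟨⟨t, ht, rfl⟩, hl⟩ := hab
    have hta : t * (t * a) = a := by rw [← mul_assoc, ht.mul_self, one_mul]
    rw [← hta]
    exact H.inHex_of_reflection hc hc' hBC hCB ht (by rwa [hta]) ih

omit H in
lemma bruhatLE_mul_simple {x y : W} {i : Fin 3} (h : bruhatLE cs x y)
    (hl : cs.length y < cs.length (y * cs.simple i)) : bruhatLE cs x (y * cs.simple i) := by
  rw [bruhatLE_iff] at *
  refine h.tail ⟨⟨y * cs.simple i * y⁻¹, ⟨y, i, rfl⟩, by simp⟩, hl⟩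

lemma mul_simple_bruhatLE {x y : W} {i : Fin 3} (h : bruhatLE cs x y)
    (hl : cs.length y < cs.length (y * cs.simple i)) :
    bruhatLE cs (x * cs.simple i) (y * cs.simple i) := by
  rw [bruhatLE_iff] at h
  induction h using Relation.ReflTransGen.head_induction_on with
  | refl => exact Or.inl rfl
  | @head a b hab hb ih =>
    obtain ⟨⟨t, ht, rfl⟩, hlt⟩ := hab
    rcases H.lt_or_eq_of_reflection ht hlt i with h | h
    · rw [bruhatLE_iff] at ih ⊢
      exact ih.head ⟨⟨t, ht, by rw [mul_assoc]⟩, by rwa [mul_assoc]⟩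
    · rw [h]
      exact bruhatLE_mul_simple (bruhatLE_iff.2 hb) hl

omit H in
/-- The alcove of `y` has coordinates `(A, B)`, and every alcove whose coordinates satisfy `S`
lies below it in the Bruhat order. -/
def Below (cs : CoxeterSystem M W) (act : W →* Equiv.Perm E2) (y : W) (A B : ℤ)
    (S : ℤ → ℤ → Prop) : Prop :=
  cx act y = A ∧ cy act y = B ∧ ∀ x, S (cx act x) (cy act x) → bruhatLE cs x y

lemma below_mul_simple {y : W} {A B A' B' : ℤ} {S S' : ℤ → ℤ → Prop} (i : Fin 3)
    (hy : Below cs act y A B S) (hn : Nbr (i : ℕ) A B A' B') (hl : alcLen A B < alcLen A' B')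
    (hS : ∀ p q p' q', Nbr (i : ℕ) p q p' q' → S' p q → S p q ∨ S p' q') :
    Below cs act (y * cs.simple i) A' B' S' := by
  obtain ⟨rfl, rfl, hy⟩ := hy
  obtain ⟨e1, e2⟩ := (H.nbr y i).unique hn
  have hl' : cs.length y < cs.length (y * cs.simple i) := by
    rwa [H.length_eq, H.length_eq, e1, e2]
  refine ⟨e1, e2, fun x hx => ?_⟩
  rcases hS _ _ _ _ (H.nbr x i) hx with h | h
  · exact bruhatLE_mul_simple (hy _ h) hl'
  · simpa using H.mul_simple_bruhatLE (hy _ h) hl'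

lemma bruhatLE_iff_inHex {y : W} {A B C c p q : ℤ} (hc : 0 ≤ c) (hc' : c ≤ 3) (hBC : B ≤ C)
    (hCB : C + c ≤ B + 3) (hy : Below cs act y p q (InHex A B C c)) (hpq : InHex A B C c p q)
    (x : W) :
    bruhatLE cs x y ↔ InHex A B C c (cx act x) (cy act x) := by
  obtain ⟨rfl, rfl, hy⟩ := hy
  exact ⟨fun h => H.inHex_of_bruhatLE hc hc' hBC hCB h hpq, hy x⟩

/-- The lower intervals of `y` and `s₀ y` contain the expected hexagons, where `y` is dominant
with coordinates `(A, B)`. -/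
def _root_.DomBelow (cs : CoxeterSystem M W) (act : W →* Equiv.Perm E2) (y : W) (A B : ℤ) : Prop :=
  Below cs act y A B (InHex A B B 0) ∧
    Below cs act (cs.simple 0 * y) (-B - 3) (-A - 3) (InHex A B B 3)

lemma domBelow_of_nbr {y y' : W} {A B A' B' : ℤ} (i : Fin 3) (hy : DomBelow cs act y A B)
    (hx' : cx act y' = A') (hy' : cy act y' = B') (hn : Nbr (i : ℕ) A B A' B')
    (hl : alcLen A B < alcLen A' B')
    (hl0 : alcLen (-B - 3) (-A - 3) < alcLen (-B' - 3) (-A' - 3))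
    (hS : ∀ c : ℤ, c = 0 ∨ c = 3 → ∀ p q p' q', Nbr (i : ℕ) p q p' q' → InHex A' B' B' c p q →
      InHex A B B c p q ∨ InHex A B B c p' q') :
    DomBelow cs act y' A' B' := by
  have h1 := H.below_mul_simple i hy.1 hn hl (hS 0 (Or.inl rfl))
  have h2 := H.below_mul_simple i hy.2 hn.simple_zero hl0 (hS 3 (Or.inr rfl))
  obtain rfl : y * cs.simple i = y' := H.ext (h1.1.trans hx'.symm) (h1.2.1.trans hy'.symm)
  exact ⟨h1, by rwa [mul_assoc] at h2⟩

lemma domBelow_base {y : W} (hx : cx act y = 1) (hy : cy act y = 1) : DomBelow cs act y 1 1 := by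
  have b : Below cs act 1 (-1) (-1) (fun p q => p = -1 ∧ q = -1) :=
    ⟨cx_one, cy_one, fun x h => Or.inl (H.ext (h.1.trans cx_one.symm) (h.2.trans cy_one.symm))⟩
  have b0 : Below cs act (1 * cs.simple 0) (-2) (-2)
      (fun p q => (p = -1 ∧ q = -1) ∨ (p = -2 ∧ q = -2)) :=
    H.below_mul_simple 0 b (by norm_num [Nbr]) (by decide) (by
      rintro p q p' q' (h | h | h | h | h | h) <;> simp at h ⊢ <;> omega)
  have step_one {z : W} {S : ℤ → ℤ → Prop} {A B A' B' : ℤ}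
      (hz : Below cs act z A B S) (hn : Nbr 1 A B A' B') (hl : alcLen A B < alcLen A' B')
      (S' : ℤ → ℤ → Prop)
      (hS : ∀ p q p' q', Nbr 1 p q p' q' → S' p q → S p q ∨ S p' q') :=
    H.below_mul_simple 1 hz hn hl hS
  have step_two {z : W} {S : ℤ → ℤ → Prop} {A B A' B' : ℤ}
      (hz : Below cs act z A B S) (hn : Nbr 2 A B A' B') (hl : alcLen A B < alcLen A' B')
      (S' : ℤ → ℤ → Prop)
      (hS : ∀ p q p' q', Nbr 2 p q p' q' → S' p q → S p q ∨ S p' q') :=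
    H.below_mul_simple 2 hz hn hl hS
  have c1 := step_one b (A' := 0) (B' := -1) (by norm_num [Nbr]) (by decide)
    (fun p q => q = -1 ∧ -1 ≤ p ∧ p ≤ 0) (by
      rintro p q p' q' (h | h | h | h | h | h) <;> omega)
  have c2 := step_two c1 (A' := 1) (B' := 0) (by norm_num [Nbr]) (by decide)
    (InHex 1 0 1 0) (by
      rintro p q p' q' (h | h | h | h | h | h) <;> unfold InHex <;> omega)
  have c3 := step_one c2 (A' := 1) (B' := 1) (by norm_num [Nbr]) (by decide)
    (InHex 1 1 1 0) (by
      rintro p q p' q' (h | h | h | h | h | h) <;> unfold InHex <;> omega)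
  have d1 := step_one b0 (A' := -2) (B' := -3) (by norm_num [Nbr]) (by decide)
    (fun p q => (q = -1 ∧ -1 ≤ p ∧ p ≤ 0) ∨ (p = -2 ∧ -3 ≤ q ∧ q ≤ -2)) (by
      rintro p q p' q' (h | h | h | h | h | h) <;> omega)
  have d2 := step_two d1 (A' := -3) (B' := -4) (by norm_num [Nbr]) (by decide)
    (fun p q => InHex 1 0 1 0 p q ∨ InHex 1 0 1 0 (-q - 3) (-p - 3)) (by
      rintro p q p' q' (h | h | h | h | h | h) <;> unfold InHex <;> omega)
  have d3 := step_one d2 (A' := -4) (B' := -4) (by norm_num [Nbr]) (by decide)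
    (InHex 1 1 1 3) (by
      rintro p q p' q' (h | h | h | h | h | h) <;> unfold InHex <;> omega)
  obtain rfl : 1 * cs.simple 1 * cs.simple 2 * cs.simple 1 = y :=
    H.ext (c3.1.trans hx.symm) (c3.2.1.trans hy.symm)
  exact ⟨c3, by norm_num [mul_assoc] at d3 ⊢; exact d3⟩

omit H in
lemma exists_fin_eq_emod (a : ℤ) : ∃ i : Fin 3, ((i : ℕ) : ℤ) = a % 3 :=
  ⟨⟨(a % 3).toNat, by omega⟩, by simp; omega⟩

lemma domBelow_ths_of_th {y y' : W} (m n : ℕ)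
    (hy : DomBelow cs act y (2 * m + n + 1) (m + 2 * n + 1))
    (hx' : cx act y' = 2 * m + n + 2) (hy' : cy act y' = m + 2 * n + 2) :
    DomBelow cs act y' (2 * m + n + 2) (m + 2 * n + 2) := by
  obtain ⟨i, hi⟩ := exists_fin_eq_emod (2 * m + n : ℤ)
  refine H.domBelow_of_nbr i hy hx' hy' ?_ ?_ ?_ ?_
  · right; right; right; left; omega
  · simp only [alcLen]; omega
  · simp only [alcLen]; omega
  · rintro c hc p q p' q' (h | h | h | h | h | h) <;> unfold InHex <;> omega

lemma domBelow_th_of_ths_left {y y' : W} (m n : ℕ)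
    (hy : DomBelow cs act y (2 * m + n + 2) (m + 2 * n + 2))
    (hx' : cx act y' = 2 * m + n + 3) (hy' : cy act y' = m + 2 * n + 2) :
    DomBelow cs act y' (2 * m + n + 3) (m + 2 * n + 2) := by
  obtain ⟨i, hi⟩ := exists_fin_eq_emod (2 * m + n + 1 : ℤ)
  refine H.domBelow_of_nbr i hy hx' hy' ?_ ?_ ?_ ?_
  · left; omega
  · simp only [alcLen]; omega
  · simp only [alcLen]; omega
  · rintro c hc p q p' q' (h | h | h | h | h | h) <;> unfold InHex <;> omega

lemma domBelow_th_of_ths_right {y y' : W} (m n : ℕ)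
    (hy : DomBelow cs act y (2 * m + n + 2) (m + 2 * n + 2))
    (hx' : cx act y' = 2 * m + n + 2) (hy' : cy act y' = m + 2 * n + 3) :
    DomBelow cs act y' (2 * m + n + 2) (m + 2 * n + 3) := by
  obtain ⟨i, hi⟩ := exists_fin_eq_emod (2 * m + n + 2 : ℤ)
  refine H.domBelow_of_nbr i hy hx' hy' ?_ ?_ ?_ ?_
  · right; left; omega
  · simp only [alcLen]; omega
  · simp only [alcLen]; omega
  · rintro c hc p q p' q' (h | h | h | h | h | h) <;> unfold InHex <;> omega

lemma domBelow_th {th ths : ℕ → ℕ → W}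
    (hth : ∀ m n : ℕ, cx act (th m n) = 2 * m + n + 1 ∧ cy act (th m n) = m + 2 * n + 1)
    (hths : ∀ m n : ℕ, cx act (ths m n) = 2 * m + n + 2 ∧ cy act (ths m n) = m + 2 * n + 2)
    (m n : ℕ) : DomBelow cs act (th m n) (2 * m + n + 1) (m + 2 * n + 1) := by
  induction m with
  | zero =>
    induction n with
    | zero =>
      have := hth 0 0
      norm_num at this ⊢
      exact H.domBelow_base this.1 this.2
    | succ n ih =>
      have h1 := H.domBelow_ths_of_th 0 n ih (hths 0 n).1 (hths 0 n).2
      have := H.domBelow_th_of_ths_right 0 n h1 (y' := th 0 (n + 1))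
        (by rw [(hth _ _).1]; push_cast; ring) (by rw [(hth _ _).2]; push_cast; ring)
      convert this using 1 <;> push_cast <;> ring
  | succ m ih =>
    have h1 := H.domBelow_ths_of_th m n ih (hths m n).1 (hths m n).2
    have := H.domBelow_th_of_ths_left m n h1 (y' := th (m + 1) n)
      (by rw [(hth _ _).1]; push_cast; ring) (by rw [(hth _ _).2]; push_cast; ring)
    convert this using 1 <;> push_cast <;> ring

lemma below_xelt (k : ℕ) (hk : 2 ≤ k) :
    Below cs act (xelt cs k) (k - 1) ((k : ℤ) / 2 - 1)
      (InHex (k - 1) ((k : ℤ) / 2 - 1) (((k : ℤ) + 1) / 2) 0) := by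
  induction k, hk using Nat.le_induction with
  | base =>
    have b : Below cs act 1 (-1) (-1) (fun p q => p = -1 ∧ q = -1) :=
      ⟨cx_one, cy_one, fun x h => Or.inl (H.ext (h.1.trans cx_one.symm) (h.2.trans cy_one.symm))⟩
    have c1 : Below cs act (1 * cs.simple 1) 0 (-1) (fun p q => q = -1 ∧ -1 ≤ p ∧ p ≤ 0) :=
      H.below_mul_simple 1 b (by norm_num [Nbr]) (by decide) (by
        rintro p q p' q' (h | h | h | h | h | h) <;> simp at h ⊢ <;> omega)
    have c2 : Below cs act (1 * cs.simple 1 * cs.simple 2) 1 0 (InHex 1 0 1 0) :=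
      H.below_mul_simple 2 c1 (by norm_num [Nbr]) (by decide) (by
        rintro p q p' q' (h | h | h | h | h | h) <;> simp [InHex] at h ⊢ <;> omega)
    have hx : xelt cs 2 = 1 * cs.simple 1 * cs.simple 2 := by
      simp [xelt, List.range_succ]
    rw [hx]
    norm_num at c2 ⊢
    exact c2
  | succ k hk ih =>
    have hx : xelt cs (k + 1) = xelt cs k *
        cs.simple (⟨(k + 1) % 3, Nat.mod_lt _ (by norm_num)⟩ : Fin 3) := by
      simp [xelt, List.range_succ]
    rw [hx]
    refine H.below_mul_simple _ ih ?_ ?_ ?_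
    · rcases Nat.even_or_odd' k with ⟨j, rfl | rfl⟩
      · left; push_cast; omega
      · right; right; right; left; push_cast; omega
    · rcases Nat.even_or_odd' k with ⟨j, rfl | rfl⟩
      · rw [show ((2 * j : ℕ) : ℤ) / 2 = j by omega,
          show (((2 * j + 1 : ℕ) : ℤ)) / 2 = j by omega]
        simp only [alcLen]; push_cast; omega
      · rw [show ((2 * j + 1 : ℕ) : ℤ) / 2 = j by omega,
          show (((2 * j + 1 + 1 : ℕ) : ℤ)) / 2 = j + 1 by omega]
        simp only [alcLen]; push_cast; omega
    · push_cast
      rintro p q p' q' (h | h | h | h | h | h) <;> unfold InHex <;> omega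

lemma bruhatLE_iff_mem_convexHull {y : W} {A B C c p q : ℤ} (hc : 0 ≤ c) (hc' : c ≤ 3)
    (hBC : B ≤ C) (hCB : C + c ≤ B + 3) (hy : Below cs act y p q (InHex A B C c))
    (hpq : InHex A B C c p q) {V : Set E2} (hV : V ⊆ hexRegion A B C c)
    (hV' : ∀ p q : ℤ, pt p q ∈ hexRegion A B C c → pt p q ∈ convexHull ℝ V) (x : W) :
    bruhatLE cs x y ↔ cen act x ∈ convexHull ℝ V := by
  rw [H.bruhatLE_iff_inHex hc hc' hBC hCB hy hpq, ← pt_mem_hexRegion_iff, H.cen_eq]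
  exact ⟨hV' _ _, fun h => convexHull_min hV (convex_hexRegion _ _ _ _) h⟩

lemma inHex_of_mem_closure {y : W} {A B : ℤ} (hy : InHex A B B 0 (cx act y) (cy act y)) {w : W}
    (hw : w ∈ Subgroup.closure {cs.simple 1, cs.simple 2}) :
    InHex A B B 0 (cx act (w * y)) (cy act (w * y)) := by
  have step (s : W) (hs : s ∈ ({cs.simple 1, cs.simple 2} : Set W)) (w : W)
      (h : InHex A B B 0 (cx act (w * y)) (cy act (w * y))) :
      InHex A B B 0 (cx act (s * w * y)) (cy act (s * w * y)) := by
    rw [mul_assoc]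
    rcases hs with rfl | rfl
    · rw [H.cx_one_mul, H.cy_one_mul]
      unfold InHex at *
      omega
    · rw [H.cx_two_mul, H.cy_two_mul]
      unfold InHex at *
      omega
  induction hw using Subgroup.closure_induction_left with
  | one => simpa using hy
  | mul_left s hs w _ ih => exact step s hs w ih
  | inv_mul_cancel s hs w _ ih =>
    refine step s⁻¹ ?_ w ih
    rcases hs with rfl | rfl <;> simp

lemma bruhatLE_iff_of_domBelow {y : W} {A B : ℤ} (hy : DomBelow cs act y A B)
    (hA : 0 < 2 * A - B) (hB : 0 < 2 * B - A) (x : W) :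
    bruhatLE cs x y ↔ cen act x ∈ convexHull ℝ
      {p : E2 | ∃ w ∈ Subgroup.closure {cs.simple 1, cs.simple 2}, p = act w (cen act y)} := by
  have hAB : InHex A B B 0 A B := by unfold InHex; omega
  refine H.bruhatLE_iff_mem_convexHull le_rfl (by norm_num) le_rfl (by omega) hy.1 hAB ?_ ?_ x
  · rintro _ ⟨w, hw, rfl⟩
    rw [← cen_mul, H.cen_eq, pt_mem_hexRegion_iff]
    exact H.inHex_of_mem_closure (by rwa [hy.1.1, hy.1.2.1]) hw
  · intro p q h
    have m1 : cs.simple 1 ∈ Subgroup.closure {cs.simple 1, cs.simple 2} :=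
      Subgroup.subset_closure (by simp)
    have m2 : cs.simple 2 ∈ Subgroup.closure {cs.simple 1, cs.simple 2} :=
      Subgroup.subset_closure (by simp)
    have mem {w : W} {p q : ℤ} (hw : w ∈ Subgroup.closure {cs.simple 1, cs.simple 2})
        (hp : cx act (w * y) = p) (hq : cy act (w * y) = q) : pt p q ∈ convexHull ℝ
          {p : E2 | ∃ w ∈ Subgroup.closure {cs.simple 1, cs.simple 2}, p = act w (cen act y)} :=
      subset_convexHull ℝ _ ⟨w, hw, (H.cen_of_coord hp hq).symm.trans (cen_mul w y)⟩
    have a1 := hy.1.1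
    have a2 := hy.1.2.1
    refine pt_mem_of_hexagon (convex_convexHull ℝ _) (mem (one_mem _) ?_ ?_) (mem m1 ?_ ?_)
      (mem m2 ?_ ?_) (mem (mul_mem (mul_mem m1 m2) m1) ?_ ?_) (mem (mul_mem m1 m2) ?_ ?_)
      (mem (mul_mem m2 m1) ?_ ?_) h <;>
      simp only [one_mul, mul_assoc, H.cx_one_mul, H.cy_one_mul, H.cx_two_mul, H.cy_two_mul] <;>
      omega

lemma bruhatLE_zero_mul_iff_of_domBelow {z : W} {A B : ℤ} (hz : DomBelow cs act z A B)
    (hA : 0 < 2 * A - B) (hB : 0 < 2 * B - A) (x : W) :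
    bruhatLE cs x (cs.simple 0 * z) ↔ cen act x ∈ convexHull ℝ
      ({cen act z, cen act (cs.simple 1 * z), cen act (cs.simple 2 * z),
        cen act (cs.simple 0 * z), cen act (cs.simple 0 * cs.simple 1 * z),
        cen act (cs.simple 0 * cs.simple 2 * z)} : Set E2) := by
  obtain ⟨hx, hy, -⟩ := hz.1
  rw [mul_assoc, mul_assoc, H.cen_of_coord hx hy,
    H.cen_of_coord (x := cs.simple 1 * z) (p := B - A) (q := B)
      (by rw [H.cx_one_mul, hx, hy]) (by rw [H.cy_one_mul, hy]),
    H.cen_of_coord (x := cs.simple 2 * z) (p := A) (q := A - B)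
      (by rw [H.cx_two_mul, hx]) (by rw [H.cy_two_mul, hx, hy]),
    H.cen_of_coord (x := cs.simple 0 * z) (p := -B - 3) (q := -A - 3)
      (by rw [H.cx_zero_mul, hy]) (by rw [H.cy_zero_mul, hx]),
    H.cen_of_coord (x := cs.simple 0 * (cs.simple 1 * z)) (p := -B - 3) (q := A - B - 3)
      (by rw [H.cx_zero_mul, H.cy_one_mul, hy])
      (by rw [H.cy_zero_mul, H.cx_one_mul, hx, hy, neg_sub]),
    H.cen_of_coord (x := cs.simple 0 * (cs.simple 2 * z)) (p := B - A - 3) (q := -A - 3)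
      (by rw [H.cx_zero_mul, H.cy_two_mul, hx, hy, neg_sub])
      (by rw [H.cy_zero_mul, H.cx_two_mul, hx])]
  refine H.bruhatLE_iff_mem_convexHull (A := A) (B := B) (C := B) (c := 3) (by norm_num) le_rfl
    le_rfl le_rfl hz.2 (by unfold InHex; omega) ?_ ?_ x
  · rintro _ (rfl | rfl | rfl | rfl | rfl | rfl) <;>
      exact pt_mem_hexRegion_iff.2 (by unfold InHex; omega)
  · intro p q h
    refine pt_mem_of_hexagon (convex_convexHull ℝ _) ?_ ?_ ?_ ?_ ?_ ?_ h <;>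
      exact subset_convexHull ℝ _ (by simp)

lemma bruhatLE_xelt_iff {k : ℕ} (hk : 2 ≤ k) (x : W) :
    bruhatLE cs x (xelt cs k) ↔ cen act x ∈ convexHull ℝ
      ({cen act (xelt cs k), cen act (cs.simple 1 * xelt cs k),
        cen act (cs.simple 2 * cs.simple 1 * xelt cs k),
        cen act (cs.simple 1 * cs.simple 2 * cs.simple 1 * xelt cs k)} : Set E2) := by
  have hbelow := H.below_xelt k hk
  obtain ⟨A, hA⟩ : ∃ A : ℤ, A = k - 1 := ⟨_, rfl⟩
  obtain ⟨B, hB⟩ : ∃ B : ℤ, B = (k : ℤ) / 2 - 1 := ⟨_, rfl⟩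
  rw [show ((k : ℤ) + 1) / 2 = A - B by omega, ← hA, ← hB] at hbelow
  have hx := hbelow.1
  have hy := hbelow.2.1
  have hx1 : cx act (cs.simple 1 * xelt cs k) = B - A := by rw [H.cx_one_mul, hx, hy]
  have hy1 : cy act (cs.simple 1 * xelt cs k) = B := by rw [H.cy_one_mul, hy]
  have hx2 : cx act (cs.simple 2 * (cs.simple 1 * xelt cs k)) = B - A := by rw [H.cx_two_mul, hx1]
  have hy2 : cy act (cs.simple 2 * (cs.simple 1 * xelt cs k)) = -A := by
    rw [H.cy_two_mul, hx1, hy1]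
    ring
  rw [mul_assoc, mul_assoc, mul_assoc, H.cen_of_coord hx hy, H.cen_of_coord hx1 hy1,
    H.cen_of_coord hx2 hy2,
    H.cen_of_coord (x := cs.simple 1 * (cs.simple 2 * (cs.simple 1 * xelt cs k))) (p := -B)
      (q := -A) (by rw [H.cx_one_mul, hx2, hy2]; ring) (by rw [H.cy_one_mul, hy2])]
  refine H.bruhatLE_iff_mem_convexHull (A := A) (B := B) (C := A - B) (c := 0) le_rfl (by norm_num)
    (by omega) (by omega) hbelow (by unfold InHex; omega) ?_ ?_ x
  · rintro _ (rfl | rfl | rfl | rfl) <;>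
      exact pt_mem_hexRegion_iff.2 (by unfold InHex; omega)
  · intro p q h
    refine pt_mem_of_trapezoid (convex_convexHull ℝ _) ?_ ?_ ?_ ?_ h <;>
      exact subset_convexHull ℝ _ (by simp)

lemma exists_domBelow {th ths : ℕ → ℕ → W}
    (hth : ∀ m n : ℕ, cen act (th m n) =
      cen act (cs.simple 1 * cs.simple 2 * cs.simple 1) + (m : ℝ) • fw1 + (n : ℝ) • fw2)
    (hths : ∀ m n : ℕ, cen act (ths m n) =
      cen act 1 + ((m : ℝ) + 1) • fw1 + ((n : ℝ) + 1) • fw2)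
    {y : W} (hy : y ∈ Dset th ths) :
    ∃ A B : ℤ, DomBelow cs act y A B ∧ 0 < 2 * A - B ∧ 0 < 2 * B - A := by
  have e : cen act (cs.simple 1 * cs.simple 2 * cs.simple 1) = pt 1 1 := by
    have := H.cen_one_mul (H.cen_two_mul (H.cen_one_mul (cen_one (act := act))))
    rw [mul_one, ← mul_assoc] at this
    rw [this]
    norm_num
  have hth' (m n : ℕ) : cx act (th m n) = 2 * m + n + 1 ∧ cy act (th m n) = m + 2 * n + 1 := by
    have h : cen act (th m n) = pt (2 * m + n + 1 : ℤ) (m + 2 * n + 1 : ℤ) := by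
      rw [hth, e]
      ext <;> simp [pt, fw1, fw2] <;> ring
    exact ⟨cx_of_cen h, cy_of_cen h⟩
  have hths' (m n : ℕ) :
      cx act (ths m n) = 2 * m + n + 2 ∧ cy act (ths m n) = m + 2 * n + 2 := by
    have h : cen act (ths m n) = pt (2 * m + n + 2 : ℤ) (m + 2 * n + 2 : ℤ) := by
      rw [hths, cen_one]
      ext <;> simp [pt, fw1, fw2] <;> ring
    exact ⟨cx_of_cen h, cy_of_cen h⟩
  rcases hy with ⟨m, n, rfl⟩ | ⟨m, n, rfl⟩
  · exact ⟨_, _, H.domBelow_th hth' hths' m n, by omega, by omega⟩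
  · exact ⟨_, _, H.domBelow_ths_of_th m n (H.domBelow_th hth' hths' m n) (hths' m n).1
      (hths' m n).2, by omega, by omega⟩

end IsStdAction

end Alcoves

/-- Euclidean description of all lower Bruhat intervals in type `Ã₂`. -/
theorem statement3
    {W : Type*} [Group W] {M : CoxeterMatrix (Fin 3)} (cs : CoxeterSystem M W)
    (hM : ∀ i j : Fin 3, M i j = if i = j then 1 else 3)
    (act : W →* Equiv.Perm E2)
    (h0 : ∀ v, act (cs.simple 0) v = reflE rho2 (-1) v)
    (h1 : ∀ v, act (cs.simple 1) v = reflE a1 0 v)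
    (h2 : ∀ v, act (cs.simple 2) v = reflE a2 0 v)
    (hcen : Function.Injective (cen act))
    (th ths : ℕ → ℕ → W)
    (hth : ∀ m n : ℕ, cen act (th m n) =
      cen act (cs.simple 1 * cs.simple 2 * cs.simple 1) + (m : ℝ) • fw1 + (n : ℝ) • fw2)
    (hths : ∀ m n : ℕ, cen act (ths m n) =
      cen act 1 + ((m : ℝ) + 1) • fw1 + ((n : ℝ) + 1) • fw2) :
    (∀ y ∈ Dset th ths, ∀ x : W,
        bruhatLE cs x y ↔ cen act x ∈ convexHull ℝ
          {p : E2 | ∃ w ∈ Subgroup.closure {cs.simple 1, cs.simple 2}, p = act w (cen act y)}) ∧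
    (∀ z ∈ Dset th ths, ∀ x : W,
        bruhatLE cs x (cs.simple 0 * z) ↔ cen act x ∈ convexHull ℝ
          ({cen act z, cen act (cs.simple 1 * z), cen act (cs.simple 2 * z),
             cen act (cs.simple 0 * z), cen act (cs.simple 0 * cs.simple 1 * z),
             cen act (cs.simple 0 * cs.simple 2 * z)} : Set E2)) ∧
    (∀ k : ℕ, 2 ≤ k → ∀ x : W,
        bruhatLE cs x (xelt cs k) ↔ cen act x ∈ convexHull ℝ
          ({cen act (xelt cs k), cen act (cs.simple 1 * xelt cs k),
             cen act (cs.simple 2 * cs.simple 1 * xelt cs k),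
             cen act (cs.simple 1 * cs.simple 2 * cs.simple 1 * xelt cs k)} : Set E2)) := by
  have H : IsStdAction cs act := ⟨h0, h1, h2, hcen⟩
  refine ⟨fun y hy x => ?_, fun z hz x => ?_, fun k hk x => H.bruhatLE_xelt_iff hk x⟩
  · obtain ⟨A, B, h, hA, hB⟩ := H.exists_domBelow hth hths hy
    exact H.bruhatLE_iff_of_domBelow h hA hB x
  · obtain ⟨A, B, h, hA, hB⟩ := H.exists_domBelow hth hths hz
    exact H.bruhatLE_zero_mul_iff_of_domBelow h hA hB x
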